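/- If m ≠ n are positive integers and x is a nonzero real number with Φ_m(x) = Φ_n(x), then 1/2 < |x| < 2, except when {m, n} = {2, 6} and x = 2. -/

import Mathlib

open Polynomial

/-- The product of the powers `(1 - t ^ d) ^ c d` over `d ∈ S`. -/
noncomputable def powProd (c : ℕ → ℤ) (S : Finset ℕ) (t : ℝ) : ℝ :=
  ∏ d ∈ S, (1 - t ^ d) ^ c d

lemma pow_le_half {t : ℝ} (h0 : 0 < t) (ht : t ≤ 1 / 2) {d : ℕ} (hd : d ≠ 0) : t ^ d ≤ 1 / 2 :=
  (pow_le_of_le_one h0.le (by linarith) hd).trans ht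

lemma one_sub_pow_pos {t : ℝ} (h0 : 0 < t) (ht : t < 1) {d : ℕ} (hd : d ≠ 0) : 0 < 1 - t ^ d :=
  sub_pos.2 (pow_lt_one₀ h0.le ht hd)

lemma sum_Ico_pow_add_le {t : ℝ} (h0 : 0 < t) (ht : t ≤ 1 / 2) (k j : ℕ) :
    ∑ d ∈ Finset.Ico (k + 1) (k + 1 + j), t ^ d + t ^ (k + j) ≤ t ^ k := by
  induction j with
  | zero => simp
  | succ j ih =>
    rw [← add_assoc (k + 1), Finset.sum_Ico_succ_top (by omega)]
    have h1 : t ^ (k + 1 + j) = t * t ^ (k + j) := by ring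
    have h2 : t ^ (k + (j + 1)) = t * t ^ (k + j) := by ring
    have : 0 < t ^ (k + j) := by positivity
    nlinarith

lemma sum_pow_lt {t : ℝ} (h0 : 0 < t) (ht : t ≤ 1 / 2) {k : ℕ} {S : Finset ℕ}
    (hS : ∀ d ∈ S, k < d) : ∑ d ∈ S, t ^ d < t ^ k := by
  have hsub : S ⊆ Finset.Ico (k + 1) (k + 1 + S.sup id) := by
    intro d hd
    have := hS d hd
    have : d ≤ S.sup id := Finset.le_sup (f := id) hd
    simp only [Finset.mem_Ico]
    omega
  have h1 := Finset.sum_le_sum_of_subset_of_nonneg (f := fun d => t ^ d) hsub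
    (fun d _ _ => by positivity)
  have h2 := sum_Ico_pow_add_le h0 ht k (S.sup id)
  have : 0 < t ^ (k + S.sup id) := by positivity
  linarith

lemma one_sub_pow_le_zpow {t : ℝ} (h0 : 0 < t) (ht : t ≤ 1 / 2) {d : ℕ} (hd : d ≠ 0) {c : ℤ}
    (hc : |c| ≤ 1) : 1 - t ^ d ≤ (1 - t ^ d) ^ c := by
  have h := one_sub_pow_pos h0 (by linarith) hd
  have h1 : 1 - t ^ d ≤ 1 := by linarith [pow_pos h0 d]
  conv_lhs => rw [← zpow_one (1 - t ^ d)]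
  exact zpow_le_zpow_right_of_le_one₀ h h1 (abs_le.1 hc).2

lemma one_sub_sum_pow_le_powProd {t : ℝ} (h0 : 0 < t) (ht : t ≤ 1 / 2) {c : ℕ → ℤ}
    {S : Finset ℕ} (hS : ∀ d ∈ S, d ≠ 0) (hc : ∀ d ∈ S, |c d| ≤ 1) :
    1 - ∑ d ∈ S, t ^ d ≤ powProd c S t := by
  classical
  have key : 1 - ∑ d ∈ S, t ^ d ≤ ∏ d ∈ S, (1 - t ^ d) := by
    clear hc
    induction S using Finset.induction_on with
    | empty => simp
    | insert a S ha ih =>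
      rw [Finset.sum_insert ha, Finset.prod_insert ha]
      have ih := ih fun d hd => hS d (Finset.mem_insert_of_mem hd)
      have h1 := one_sub_pow_pos h0 (by linarith) (hS a (Finset.mem_insert_self _ _))
      have h2 : 0 ≤ ∑ d ∈ S, t ^ d := Finset.sum_nonneg fun d _ => by positivity
      have h3 : 0 < t ^ a := by positivity
      nlinarith [mul_le_mul_of_nonneg_left ih h1.le, mul_nonneg h2 h3.le]
  refine key.trans (Finset.prod_le_prod ?_ ?_)
  · exact fun d hd => (one_sub_pow_pos h0 (by linarith) (hS d hd)).le
  · exact fun d hd => one_sub_pow_le_zpow h0 ht (hS d hd) (hc d hd)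

lemma one_sub_pow_lt_powProd {t : ℝ} (h0 : 0 < t) (ht : t ≤ 1 / 2) {c : ℕ → ℤ} {k : ℕ}
    {S : Finset ℕ} (hS : ∀ d ∈ S, k < d) (hc : ∀ d ∈ S, |c d| ≤ 1) :
    1 - t ^ k < powProd c S t := by
  have h1 := sum_pow_lt h0 ht hS
  have h2 := one_sub_sum_pow_le_powProd h0 ht (fun d hd => by have := hS d hd; omega) hc
  linarith

lemma powProd_pos {t : ℝ} (h0 : 0 < t) (ht : t ≤ 1 / 2) {c : ℕ → ℤ} {S : Finset ℕ}
    (hS : ∀ d ∈ S, d ≠ 0) : 0 < powProd c S t :=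
  Finset.prod_pos fun d hd => zpow_pos (one_sub_pow_pos h0 (by linarith) (hS d hd)) _

lemma powProd_neg (c : ℕ → ℤ) (S : Finset ℕ) (t : ℝ) :
    powProd (fun d => -c d) S t = (powProd c S t)⁻¹ := by
  simp [powProd, zpow_neg, Finset.prod_inv_distrib]

lemma powProd_lt_inv_one_sub_pow {t : ℝ} (h0 : 0 < t) (ht : t ≤ 1 / 2) {c : ℕ → ℤ} {k : ℕ}
    (hk : k ≠ 0) {S : Finset ℕ} (hS : ∀ d ∈ S, k < d) (hc : ∀ d ∈ S, |c d| ≤ 1) :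
    powProd c S t < (1 - t ^ k)⁻¹ := by
  have h := one_sub_pow_lt_powProd h0 ht (c := fun d => -c d) hS (by simpa using hc)
  rw [powProd_neg] at h
  have hp := powProd_pos h0 ht (c := c) (S := S) (fun d hd => by have := hS d hd; omega)
  exact (lt_inv_comm₀ (one_sub_pow_pos h0 (by linarith) hk) hp).1 h

/-- The first nonzero exponent determines on which side of `1` the product lies. -/
lemma powProd_lt_one {t : ℝ} (h0 : 0 < t) (ht : t ≤ 1 / 2) {c : ℕ → ℤ} {S : Finset ℕ} {k : ℕ}
    (hk : k ≠ 0) (hkS : k ∈ S) (hck : c k = 1) (hlt : ∀ d ∈ S, d < k → c d = 0)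
    (hc : ∀ d ∈ S, |c d| ≤ 1) : powProd c S t < 1 := by
  have hsplit : powProd c S t = (1 - t ^ k) * powProd c (S.filter (k < ·)) t := by
    unfold powProd
    rw [← Finset.mul_prod_erase S _ hkS, hck, zpow_one]
    congr 1
    symm
    apply Finset.prod_subset
    · intro d hd
      simp only [Finset.mem_filter] at hd
      exact Finset.mem_erase.2 ⟨by omega, hd.1⟩
    · intro d hd hd'
      simp only [Finset.mem_erase, Finset.mem_filter, not_and] at hd hd'
      have := hd' hd.2
      rw [hlt d hd.2 (by omega), zpow_zero]
  have hp := one_sub_pow_pos h0 (by linarith) hk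
  have h := powProd_lt_inv_one_sub_pow h0 ht (c := c) hk (S := S.filter (k < ·))
    (fun d hd => (Finset.mem_filter.1 hd).2) (fun d hd => hc d (Finset.mem_filter.1 hd).1)
  rw [hsplit]
  calc _ < (1 - t ^ k) * (1 - t ^ k)⁻¹ := by gcongr
    _ = 1 := mul_inv_cancel₀ hp.ne'

lemma one_lt_powProd {t : ℝ} (h0 : 0 < t) (ht : t ≤ 1 / 2) {c : ℕ → ℤ} {S : Finset ℕ} {k : ℕ}
    (hS : ∀ d ∈ S, d ≠ 0) (hkS : k ∈ S) (hck : c k = -1)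
    (hlt : ∀ d ∈ S, d < k → c d = 0) (hc : ∀ d ∈ S, |c d| ≤ 1) : 1 < powProd c S t := by
  have h := powProd_lt_one h0 ht (c := fun d => -c d) (hS k hkS) hkS (by simp [hck])
    (fun d hd hdk => by simp [hlt d hd hdk]) (by simpa using hc)
  rw [powProd_neg] at h
  exact (inv_lt_one₀ (powProd_pos h0 ht hS)).1 h

lemma powProd_ne_one {t : ℝ} (h0 : 0 < t) (ht : t ≤ 1 / 2) {c : ℕ → ℤ} {S : Finset ℕ} {k : ℕ}
    (hS : ∀ d ∈ S, d ≠ 0) (hkS : k ∈ S) (hck : c k ≠ 0) (hc : ∀ d ∈ S, |c d| ≤ 1) :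
    powProd c S t ≠ 1 := by
  have hne : (S.filter (c · ≠ 0)).Nonempty := ⟨k, by simp [hkS, hck]⟩
  obtain ⟨hm, hcm⟩ := Finset.mem_filter.1 (Finset.min'_mem _ hne)
  set j := (S.filter (c · ≠ 0)).min' hne
  have hlt : ∀ d ∈ S, d < j → c d = 0 := by
    intro d hd hdj
    by_contra hcd
    exact absurd (Finset.min'_le (S.filter (c · ≠ 0)) d (by simp [hd, hcd])) (not_le.2 hdj)
  have := abs_le.1 (hc j hm)
  obtain h | h : c j = 1 ∨ c j = -1 := by omega
  · exact (powProd_lt_one h0 ht (hS j hm) hm h hlt hc).ne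
  · exact (one_lt_powProd h0 ht hS hm h hlt hc).ne'

/-- For squarefree `q`, this is `Φ_q(t) ^ μ(q)` up to sign. -/
noncomputable def moebiusProd (q : ℕ) (t : ℝ) : ℝ :=
  powProd ArithmeticFunction.moebius q.divisors t

lemma moebiusProd_pos {t : ℝ} (h0 : 0 < t) (ht : t ≤ 1 / 2) (q : ℕ) : 0 < moebiusProd q t :=
  powProd_pos h0 ht fun _ hd => (Nat.pos_of_mem_divisors hd).ne'

lemma moebiusProd_one (t : ℝ) : moebiusProd 1 t = 1 - t := by
  simp [moebiusProd, powProd]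

lemma moebiusProd_two (t : ℝ) : moebiusProd 2 t = (1 - t) * (1 - t ^ 2)⁻¹ := by
  simp [moebiusProd, powProd, Nat.prime_two.divisors,
    ArithmeticFunction.moebius_apply_prime Nat.prime_two]

lemma moebiusProd_lt_one {t : ℝ} (h0 : 0 < t) (ht : t ≤ 1 / 2) {q : ℕ} (hq : q ≠ 0) :
    moebiusProd q t < 1 :=
  powProd_lt_one h0 ht (k := 1) one_ne_zero (by simpa using hq) (by simp)
    (fun d hd hd1 => absurd (Nat.pos_of_mem_divisors hd) (by omega))
    (fun _ _ => ArithmeticFunction.abs_moebius_le_one)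

lemma moebiusProd_eq_mul {q : ℕ} (hq : q ≠ 0) (t : ℝ) :
    moebiusProd q t = (1 - t) * powProd ArithmeticFunction.moebius (q.divisors.erase 1) t := by
  rw [moebiusProd, powProd, ← Finset.mul_prod_erase _ _ (Nat.one_mem_divisors.2 hq)]
  simp [powProd]

lemma one_sub_lt_moebiusProd {t : ℝ} (h0 : 0 < t) (ht : t ≤ 1 / 2) {q : ℕ} (hq : q ≠ 0)
    (hq1 : q ≠ 1) : 1 - t < moebiusProd q t := by
  have hp := Nat.minFac_prime hq1
  have h : 1 < powProd ArithmeticFunction.moebius (q.divisors.erase 1) t := by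
    refine one_lt_powProd h0 ht (k := q.minFac) ?_ ?_
      (ArithmeticFunction.moebius_apply_prime hp) ?_
      (fun _ _ => ArithmeticFunction.abs_moebius_le_one)
    · exact fun d hd => (Nat.pos_of_mem_divisors (Finset.mem_of_mem_erase hd)).ne'
    · simp [hq, hp.ne_one, Nat.minFac_dvd]
    · intro d hd hlt
      simp only [Finset.mem_erase, Nat.mem_divisors] at hd
      exact absurd (Nat.minFac_le_of_dvd (by
        have := Nat.pos_of_dvd_of_pos hd.2.1 (Nat.pos_of_ne_zero hq); omega) hd.2.1) (by omega)
  rw [moebiusProd_eq_mul hq]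
  nlinarith

lemma one_sub_le_moebiusProd {t : ℝ} (h0 : 0 < t) (ht : t ≤ 1 / 2) {q : ℕ} (hq : q ≠ 0) :
    1 - t ≤ moebiusProd q t := by
  rcases eq_or_ne q 1 with rfl | h1
  · rw [moebiusProd_one]
  · exact (one_sub_lt_moebiusProd h0 ht hq h1).le

lemma inv_one_add_le_moebiusProd {t : ℝ} (h0 : 0 < t) (ht : t ≤ 1 / 2) {q : ℕ}
    (hq : Squarefree q) (h2 : 2 ∣ q) : (1 + t)⁻¹ ≤ moebiusProd q t := by
  have hq0 := hq.ne_zero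
  have hfac : (1 + t)⁻¹ = (1 - t) * (1 - t ^ 2)⁻¹ := by
    have : 1 - t ^ 2 = (1 - t) * (1 + t) := by ring
    have h1 : 1 - t ≠ 0 := by linarith
    have h2 : 1 + t ≠ 0 := by linarith
    rw [this]
    field_simp
  rw [hfac]
  rcases eq_or_ne q 2 with rfl | hq2
  · rw [moebiusProd_two]
  set S := (q.divisors.erase 1).erase 2 with hS
  have hmem : ∀ d ∈ S, d ∣ q ∧ 2 < d := by
    intro d hd
    simp only [hS, Finset.mem_erase, Nat.mem_divisors] at hd
    have := Nat.pos_of_dvd_of_pos hd.2.2.1 (Nat.pos_of_ne_zero hq0)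
    exact ⟨hd.2.2.1, by omega⟩
  have hmul : moebiusProd q t =
      (1 - t) * (1 - t ^ 2)⁻¹ * powProd ArithmeticFunction.moebius S t := by
    have h2mem : 2 ∈ q.divisors.erase 1 := by simp [hq0, h2]
    rw [moebiusProd_eq_mul hq0, powProd, ← Finset.mul_prod_erase _ _ h2mem,
      ArithmeticFunction.moebius_apply_prime Nat.prime_two, zpow_neg_one, ← hS, powProd, mul_assoc]
  have hodd : ∀ d ∈ S, ∃ p, p.Prime ∧ p ∣ d ∧ p ∈ S := by
    intro d hd
    obtain ⟨hdq, hd2⟩ := hmem d hd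
    rcases Nat.eq_two_pow_or_exists_odd_prime_and_dvd d with ⟨k, rfl⟩ | ⟨p, hp, hpd, hpo⟩
    · exfalso
      have hk : 2 ≤ k := by
        by_contra! h
        interval_cases k <;> omega
      have := hq 2 ((show 2 * 2 ∣ 2 ^ k from pow_dvd_pow 2 hk).trans hdq)
      simp at this
    · refine ⟨p, hp, hpd, ?_⟩
      simp only [hS, Finset.mem_erase, Nat.mem_divisors]
      refine ⟨?_, hp.ne_one, hpd.trans hdq, hq0⟩
      rintro rfl
      exact absurd hpo (by decide)
  have hne : S.Nonempty := by
    refine ⟨q, ?_⟩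
    simp only [hS, Finset.mem_erase, Nat.mem_divisors]
    refine ⟨hq2, ?_, dvd_rfl, hq0⟩
    rintro rfl
    simp at h2
  have hkm := S.min'_mem hne
  obtain ⟨p, hp, hpk, hpS⟩ := hodd _ hkm
  have hpe : S.min' hne = p :=
    le_antisymm (S.min'_le p hpS) (Nat.le_of_dvd (by have := hmem _ hkm; omega) hpk)
  have h : 1 < powProd ArithmeticFunction.moebius S t := by
    refine one_lt_powProd h0 ht (fun d hd => by have := hmem d hd; omega) hpS
      (ArithmeticFunction.moebius_apply_prime hp) (fun d hd hdp => ?_)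
      (fun _ _ => ArithmeticFunction.abs_moebius_le_one)
    have := S.min'_le d hd
    omega
  rw [hmul]
  have h3 : 0 < (1 + t)⁻¹ := by positivity
  rw [hfac] at h3
  nlinarith

lemma powProd_divisors_eq {q : ℕ} (hq : q ≠ 0) {S : Finset ℕ} (hS : q.divisors ⊆ S) (c : ℕ → ℤ)
    (t : ℝ) : powProd c q.divisors t = powProd (fun d => if d ∣ q then c d else 0) S t := by
  have h : powProd c q.divisors t = powProd (fun d => if d ∣ q then c d else 0) q.divisors t :=
    Finset.prod_congr rfl fun d hd => by simp [Nat.dvd_of_mem_divisors hd]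
  rw [h]
  refine Finset.prod_subset hS fun d _ hd => ?_
  have : ¬ d ∣ q := fun h => hd (by simp [h, hq])
  simp [this]

lemma moebiusProd_injective {t : ℝ} (h0 : 0 < t) (ht : t ≤ 1 / 2) {q r : ℕ}
    (hq : Squarefree q) (hr : Squarefree r) (h : moebiusProd q t = moebiusProd r t) : q = r := by
  classical
  set S := q.divisors ∪ r.divisors
  set c : ℕ → ℤ := fun d => (if d ∣ q then ArithmeticFunction.moebius d else 0) -
    (if d ∣ r then ArithmeticFunction.moebius d else 0) with hcdef
  have hS : ∀ d ∈ S, d ≠ 0 := by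
    intro d hd
    rcases Finset.mem_union.1 hd with hd | hd <;> exact (Nat.pos_of_mem_divisors hd).ne'
  have hc : ∀ d ∈ S, |c d| ≤ 1 := by
    intro d _
    have := ArithmeticFunction.abs_moebius_le_one (n := d)
    simp only [hcdef]
    split_ifs <;> simp [this]
  have hone : powProd c S t = 1 := by
    have hdiv : powProd c S t = moebiusProd q t / moebiusProd r t := by
      rw [moebiusProd, moebiusProd, powProd_divisors_eq hq.ne_zero
        (S := S) Finset.subset_union_left, powProd_divisors_eq hr.ne_zero
        (S := S) Finset.subset_union_right]
      simp only [powProd]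
      rw [← Finset.prod_div_distrib]
      refine Finset.prod_congr rfl fun d hd => ?_
      rw [hcdef, zpow_sub₀ (one_sub_pow_pos h0 (by linarith) (hS d hd)).ne']
    rw [hdiv, h, div_self (moebiusProd_pos h0 ht r).ne']
  have hz : ∀ d ∈ S, c d = 0 := fun d hd => by
    by_contra hcd
    exact powProd_ne_one h0 ht hS hd hcd hc hone
  apply Nat.dvd_antisymm
  · by_contra hqr
    have := hz q (by simp [S, hq.ne_zero])
    simp [hcdef, hqr, hq] at this
  · by_contra hqr
    have := hz r (by simp [S, hr.ne_zero])
    simp [hcdef, hqr, hr] at this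

lemma moebiusProd_lt_inv_one_add_sq {t : ℝ} (h0 : 0 < t) (ht : t ≤ 1 / 2) {q : ℕ} (hq : q ≠ 0) :
    moebiusProd q t < (1 + t ^ 2)⁻¹ := by
  set c : ℕ → ℤ := fun d => if d ∣ q then ArithmeticFunction.moebius d else 0 with hcdef
  have hsub : q.divisors ⊆ Finset.range (q + 10) := by
    intro d hd
    have := Nat.divisor_le hd
    simp only [Finset.mem_range]
    omega
  have hcabs : ∀ d, |c d| ≤ 1 := by
    intro d
    simp only [hcdef]
    split_ifs
    · exact ArithmeticFunction.abs_moebius_le_one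
    · simp
  have hfac : ∀ d ≠ 0, 0 < (1 - t ^ d) ^ c d := fun d hd =>
    zpow_pos (one_sub_pow_pos h0 (by linarith) hd) _
  have hup : ∀ d ≠ 0, (1 - t ^ d) ^ c d ≤ (1 - t ^ d)⁻¹ := by
    intro d hd
    have h := one_sub_pow_le_zpow h0 ht hd (c := -c d) (by simpa using hcabs d)
    rw [zpow_neg] at h
    exact (le_inv_comm₀ (one_sub_pow_pos h0 (by linarith) hd) (hfac d hd)).1 h
  have hsq : ∀ d, ¬ Squarefree d → c d = 0 := by
    intro d hd
    simp [hcdef, ArithmeticFunction.moebius_eq_zero_of_not_squarefree hd]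
  have hc0 : c 0 = 0 := hsq 0 (by simp)
  have hc1 : c 1 = 1 := by simp [hcdef]
  have hc4 : c 4 = 0 := hsq 4 (by decide)
  have hc8 : c 8 = 0 := hsq 8 (by decide)
  have hc9 : c 9 = 0 := hsq 9 fun h => by simpa using h 3 (by norm_num)
  have h6 : (1 - t ^ 6) ^ c 6 ≤ 1 := by
    have hc6 : c 6 = if 6 ∣ q then 1 else 0 := by
      have : ArithmeticFunction.moebius 6 = 1 := by
        rw [show 6 = 2 * 3 by norm_num,
          ArithmeticFunction.isMultiplicative_moebius.map_mul_of_coprime (by norm_num),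
          ArithmeticFunction.moebius_apply_prime Nat.prime_two,
          ArithmeticFunction.moebius_apply_prime Nat.prime_three]
        norm_num
      simp only [hcdef, this]
    rw [hc6]
    split_ifs
    · rw [zpow_one]
      linarith [pow_pos h0 6]
    · simp
  have htail := powProd_lt_inv_one_sub_pow h0 ht (c := c) (k := 9) (by norm_num)
    (S := Finset.Ico 10 (q + 10)) (fun d hd => by simp only [Finset.mem_Ico] at hd; omega)
    (fun d _ => hcabs d)
  have heq : moebiusProd q t = (1 - t) * (1 - t ^ 2) ^ c 2 * (1 - t ^ 3) ^ c 3 * (1 - t ^ 5) ^ c 5 *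
      (1 - t ^ 6) ^ c 6 * (1 - t ^ 7) ^ c 7 * powProd c (Finset.Ico 10 (q + 10)) t := by
    rw [moebiusProd, powProd_divisors_eq hq hsub, ← hcdef, powProd,
      ← Finset.prod_range_mul_prod_Ico _ (show 10 ≤ q + 10 by omega), powProd]
    congr 1
    simp [Finset.prod_range_succ, hc0, hc1, hc4, hc8, hc9]
  have hpos : ∀ d ≠ 0, 0 < 1 - t ^ d := fun d hd => one_sub_pow_pos h0 (by linarith) hd
  have p2 := hpos 2 (by norm_num)
  have p3 := hpos 3 (by norm_num)
  have p5 := hpos 5 (by norm_num)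
  have p7 := hpos 7 (by norm_num)
  have p9 := hpos 9 (by norm_num)
  have f2 := hfac 2 (by norm_num)
  have f3 := hfac 3 (by norm_num)
  have f5 := hfac 5 (by norm_num)
  have f6 := hfac 6 (by norm_num)
  have f7 := hfac 7 (by norm_num)
  have h1t : 0 < 1 - t := by linarith
  have htp : 0 < powProd c (Finset.Ico 10 (q + 10)) t :=
    powProd_pos h0 ht (fun d hd => by simp only [Finset.mem_Ico] at hd; omega)
  have hbound : moebiusProd q t ≤ (1 - t) * (1 - t ^ 2)⁻¹ * (1 - t ^ 3)⁻¹ * (1 - t ^ 5)⁻¹ *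
      1 * (1 - t ^ 7)⁻¹ * (1 - t ^ 9)⁻¹ := by
    rw [heq]
    have u2 := hup 2 (by norm_num)
    have u3 := hup 3 (by norm_num)
    have u5 := hup 5 (by norm_num)
    have u7 := hup 7 (by norm_num)
    gcongr
  refine hbound.trans_lt ?_
  have hpoly : 1 + t ^ 2 < (1 + t) * (1 - t ^ 3 - t ^ 5 - t ^ 7 - t ^ 9) := by
    have : t + (1 + t) * (t ^ 2 + t ^ 4 + t ^ 6 + t ^ 8) < 1 := by
      calc _ ≤ (1 / 2 : ℝ) + (1 + 1 / 2) *
            ((1 / 2) ^ 2 + (1 / 2) ^ 4 + (1 / 2) ^ 6 + (1 / 2) ^ 8) := by gcongr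
        _ < 1 := by norm_num
    nlinarith
  have hprod : 1 - t ^ 3 - t ^ 5 - t ^ 7 - t ^ 9 ≤
      (1 - t ^ 3) * (1 - t ^ 5) * (1 - t ^ 7) * (1 - t ^ 9) := by
    have h := one_sub_sum_pow_le_powProd h0 ht (c := fun _ => 1) (S := {3, 5, 7, 9})
      (by simp) (by simp)
    simp [powProd] at h
    linarith
  have hlt : (1 + t ^ 2) * (1 - t) <
      (1 - t ^ 2) * (1 - t ^ 3) * (1 - t ^ 5) * (1 - t ^ 7) * (1 - t ^ 9) := by
    have h1 : 1 + t ^ 2 < (1 + t) * ((1 - t ^ 3) * (1 - t ^ 5) * (1 - t ^ 7) * (1 - t ^ 9)) :=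
      hpoly.trans_le (by gcongr)
    calc _ < (1 + t) * ((1 - t ^ 3) * (1 - t ^ 5) * (1 - t ^ 7) * (1 - t ^ 9)) * (1 - t) := by
          gcongr
      _ = _ := by ring
  rw [lt_inv_comm₀ (by positivity) (by positivity), ← one_div, lt_div_iff₀ (by positivity)]
  calc _ = (1 + t ^ 2) * (1 - t) /
        ((1 - t ^ 2) * (1 - t ^ 3) * (1 - t ^ 5) * (1 - t ^ 7) * (1 - t ^ 9)) := by field_simp
    _ < 1 := (div_lt_one (by positivity)).2 hlt

lemma moebiusProd_lt_one_sub_half {t : ℝ} (h0 : 0 < t) (ht : t ≤ 1 / 4) {q : ℕ} (hq : q ≠ 0) :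
    moebiusProd q t < 1 - t / 2 := by
  have ht2 : t ≤ 1 / 2 := by linarith
  set S := (q.divisors.erase 1).erase 2 with hS
  have hmem : ∀ d ∈ S, 2 < d := by
    intro d hd
    simp only [hS, Finset.mem_erase, Nat.mem_divisors] at hd
    have := Nat.pos_of_dvd_of_pos hd.2.2.1 (Nat.pos_of_ne_zero hq)
    omega
  have p2 := one_sub_pow_pos h0 (by linarith) two_ne_zero
  have htail : powProd ArithmeticFunction.moebius S t < (1 - t ^ 2)⁻¹ :=
    powProd_lt_inv_one_sub_pow h0 ht2 two_ne_zero hmem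
      (fun _ _ => ArithmeticFunction.abs_moebius_le_one)
  have htp : 0 < powProd ArithmeticFunction.moebius S t :=
    powProd_pos h0 ht2 fun d hd => by have := hmem d hd; omega
  have h1 : powProd ArithmeticFunction.moebius (q.divisors.erase 1) t ≤
      (1 - t ^ 2)⁻¹ * powProd ArithmeticFunction.moebius S t := by
    by_cases h2 : 2 ∈ q.divisors.erase 1
    · rw [powProd, ← Finset.mul_prod_erase _ _ h2,
        ArithmeticFunction.moebius_apply_prime Nat.prime_two, zpow_neg_one, ← hS, powProd]
    · rw [hS, Finset.erase_eq_of_notMem h2]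
      rw [hS, Finset.erase_eq_of_notMem h2] at htp
      exact le_mul_of_one_le_left htp.le
        ((one_le_inv₀ p2).2 (by linarith [pow_pos h0 2]))
  rw [moebiusProd_eq_mul hq]
  have h1t : 0 < 1 - t := by linarith
  calc _ ≤ (1 - t) * ((1 - t ^ 2)⁻¹ * powProd ArithmeticFunction.moebius S t) := by gcongr
    _ < (1 - t) * ((1 - t ^ 2)⁻¹ * (1 - t ^ 2)⁻¹) := by gcongr
    _ = (1 - t) / ((1 - t ^ 2) * (1 - t ^ 2)) := by field_simp
    _ ≤ 1 - t / 2 := by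
      rw [div_le_iff₀ (by positivity)]
      have : 1 ≤ (1 - t / 2) * ((1 + t) * (1 - t ^ 2)) := by
        nlinarith [mul_nonneg h0.le (show (0 : ℝ) ≤ 1 - 3 * t - t ^ 2 + t ^ 3 by
          nlinarith [pow_pos h0 3])]
      nlinarith [mul_le_mul_of_nonneg_right this h1t.le]

lemma moebiusProd_pow_lt {x : ℝ} (h0 : 0 < x) (hx : x ≤ 1 / 2) {q r k l : ℕ} (hq : q ≠ 0)
    (hr : Squarefree r) (hk : k ≠ 0) (hkl : k < l) (hl : l = 2 → 2 ∣ r) :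
    moebiusProd q (x ^ k) < moebiusProd r (x ^ l) := by
  have hxl := pow_le_half h0 hx (show l ≠ 0 by omega)
  have hlow := one_sub_le_moebiusProd (pow_pos h0 l) hxl hr.ne_zero
  have hx1 : x ≤ 1 := by linarith
  rcases (show k = 1 ∨ 2 ≤ k by omega) with rfl | hk2
  · rw [pow_one]
    refine (moebiusProd_lt_inv_one_add_sq h0 hx hq).trans_le ?_
    rcases (show l = 2 ∨ 3 ≤ l by omega) with rfl | hl3
    · exact inv_one_add_le_moebiusProd (pow_pos h0 2) hxl hr (hl rfl)
    · have h3 : x ^ l ≤ x ^ 3 := pow_le_pow_of_le_one h0.le hx1 hl3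
      have hle : (1 + x ^ 2)⁻¹ ≤ 1 - x ^ 3 := by
        rw [inv_le_iff_one_le_mul₀ (by positivity)]
        have : x + x ^ 3 ≤ 1 := by
          calc x + x ^ 3 ≤ 1 / 2 + (1 / 2) ^ 3 := by gcongr
            _ ≤ 1 := by norm_num
        nlinarith [pow_pos h0 2]
      linarith
  · have h4 : x ^ k ≤ 1 / 4 :=
      calc x ^ k ≤ x ^ 2 := pow_le_pow_of_le_one h0.le hx1 hk2
        _ ≤ (1 / 2) ^ 2 := by gcongr
        _ = 1 / 4 := by norm_num
    have h5 : x ^ l ≤ x ^ k / 2 :=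
      calc x ^ l ≤ x ^ (k + 1) := pow_le_pow_of_le_one h0.le hx1 hkl
        _ = x ^ k * x := pow_succ _ _
        _ ≤ x ^ k * (1 / 2) := by gcongr
        _ = x ^ k / 2 := by ring
    have := moebiusProd_lt_one_sub_half (pow_pos h0 k) h4 hq
    linarith

/-- The value at `x` of `Φ_n` divided by its constant term. -/
noncomputable def normalizedCyclotomic (n : ℕ) (x : ℝ) : ℝ :=
  ∏ p ∈ n.divisorsAntidiagonal, (1 - x ^ p.2) ^ ArithmeticFunction.moebius p.1

open UniqueFactorizationMonoid in
lemma normalizedCyclotomic_eq_moebiusProd_zpow {n : ℕ} (hn : n ≠ 0) (x : ℝ) :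
    normalizedCyclotomic n x = moebiusProd (radical n) (x ^ (n / radical n)) ^
      ArithmeticFunction.moebius (radical n) := by
  have hq : Squarefree (radical n) := squarefree_radical
  have hqn : radical n ∣ n := radical_dvd_self
  rw [normalizedCyclotomic, Nat.prod_divisorsAntidiagonal
    (fun a b => (1 - x ^ b) ^ ArithmeticFunction.moebius a), moebiusProd, powProd,
    ← Finset.prod_zpow, ← Nat.prod_div_divisors (radical n)]
  symm
  refine Finset.prod_subset_one_on_sdiff (Nat.divisors_subset_of_dvd hn hqn) ?_ ?_
  · intro d hd
    simp only [Finset.mem_sdiff, Nat.mem_divisors] at hd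
    have : ¬ Squarefree d := fun h =>
      hd.2 ⟨(dvd_radical_iff h.isRadical hn).2 hd.1.1, hq.ne_zero⟩
    rw [ArithmeticFunction.moebius_eq_zero_of_not_squarefree this, zpow_zero]
  · intro d hd
    obtain ⟨b, hb⟩ := Nat.dvd_of_mem_divisors hd
    obtain ⟨k, hk⟩ := hqn
    have hd0 := Nat.pos_of_mem_divisors hd
    have hq0 := Nat.pos_of_ne_zero hq.ne_zero
    have hsq := hq
    rw [hb, Nat.squarefree_mul_iff] at hsq
    have e1 : radical n / d = b := by rw [hb, Nat.mul_div_cancel_left _ hd0]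
    have e2 : n / radical n = k := Nat.div_eq_of_eq_mul_right hq0 hk
    have e3 : n / d = k * b :=
      Nat.div_eq_of_eq_mul_right hd0 (hk.trans (by rw [hb]; ring))
    have e4 : ArithmeticFunction.moebius (radical n) =
        ArithmeticFunction.moebius d * ArithmeticFunction.moebius b := by
      rw [hb, ArithmeticFunction.isMultiplicative_moebius.map_mul_of_coprime hsq.1]
    rw [e1, e2, e3, e4, ← zpow_mul, ← pow_mul]
    congr 1
    have := ArithmeticFunction.moebius_sq_eq_one_of_squarefree hsq.2.2
    linear_combination ArithmeticFunction.moebius d * this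

open UniqueFactorizationMonoid in
lemma normalizedCyclotomic_injective {x : ℝ} (h0 : 0 < x) (hx : x ≤ 1 / 2) {m n : ℕ} (hm : m ≠ 0)
    (hn : n ≠ 0) (h : normalizedCyclotomic m x = normalizedCyclotomic n x) : m = n := by
  rw [normalizedCyclotomic_eq_moebiusProd_zpow hm, normalizedCyclotomic_eq_moebiusProd_zpow hn] at h
  have hq : Squarefree (radical m) := squarefree_radical
  have hr : Squarefree (radical n) := squarefree_radical
  have heven : ∀ a : ℕ, a ≠ 0 → a / radical a = 2 → 2 ∣ radical a := by
    intro a ha h2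
    refine (dvd_radical_iff Nat.prime_two.prime.irreducible.squarefree.isRadical ha).2 ?_
    exact ⟨radical a, by rw [← h2, Nat.div_mul_cancel radical_dvd_self]⟩
  have hpow : ∀ a : ℕ, a ≠ 0 → a / radical a ≠ 0 := fun a ha =>
    (Nat.div_pos (Nat.le_of_dvd (Nat.pos_of_ne_zero ha) radical_dvd_self)
      (Nat.radical_pos a)).ne'
  have hbd : ∀ a : ℕ, a ≠ 0 → 0 < moebiusProd (radical a) (x ^ (a / radical a)) ∧
      moebiusProd (radical a) (x ^ (a / radical a)) < 1 := fun a ha =>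
    ⟨moebiusProd_pos (pow_pos h0 _) (pow_le_half h0 hx (hpow a ha)) _,
      moebiusProd_lt_one (pow_pos h0 _) (pow_le_half h0 hx (hpow a ha)) radical_ne_zero⟩
  have hP : moebiusProd (radical m) (x ^ (m / radical m)) =
      moebiusProd (radical n) (x ^ (n / radical n)) := by
    obtain ⟨pm, pm1⟩ := hbd m hm
    obtain ⟨pn, pn1⟩ := hbd n hn
    rcases ArithmeticFunction.moebius_ne_zero_iff_eq_or.1
      (ArithmeticFunction.moebius_ne_zero_iff_squarefree.2 hq) with e | e <;>
    rcases ArithmeticFunction.moebius_ne_zero_iff_eq_or.1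
      (ArithmeticFunction.moebius_ne_zero_iff_squarefree.2 hr) with e' | e' <;>
    simp only [e, e', zpow_one, zpow_neg_one] at h
    · exact h
    · have := (one_lt_inv₀ pn).2 pn1
      linarith
    · have := (one_lt_inv₀ pm).2 pm1
      linarith
    · exact inv_injective h
  have hk : m / radical m = n / radical n := by
    rcases lt_trichotomy (m / radical m) (n / radical n) with hlt | heq | hlt
    · exact absurd hP
        (moebiusProd_pow_lt h0 hx hq.ne_zero hr (hpow m hm) hlt (heven n hn)).ne
    · exact heq
    · exact absurd hP
        (moebiusProd_pow_lt h0 hx hr.ne_zero hq (hpow n hn) hlt (heven m hm)).ne'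
  rw [hk] at hP
  have hrad := moebiusProd_injective (pow_pos h0 _) (pow_le_half h0 hx (hpow n hn)) hq hr hP
  calc m = m / radical m * radical m := (Nat.div_mul_cancel radical_dvd_self).symm
    _ = n / radical n * radical n := by rw [hk, hrad]
    _ = n := Nat.div_mul_cancel radical_dvd_self

open UniqueFactorizationMonoid in
lemma normalizedCyclotomic_mem_Ico {x : ℝ} (h0 : 0 < x) (hx : x ≤ 1 / 2) {n : ℕ} (hn : n ≠ 0) :
    1 / 2 ≤ normalizedCyclotomic n x ∧ normalizedCyclotomic n x < 2 := by
  have hk : n / radical n ≠ 0 :=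
    (Nat.div_pos (Nat.le_of_dvd (Nat.pos_of_ne_zero hn) radical_dvd_self)
      (Nat.radical_pos n)).ne'
  have ht := pow_le_half h0 hx hk
  have ht0 := pow_pos h0 (n / radical n)
  have hq : Squarefree (radical n) := squarefree_radical
  rw [normalizedCyclotomic_eq_moebiusProd_zpow hn]
  have hpos := moebiusProd_pos ht0 ht (radical n)
  have hlt := moebiusProd_lt_one ht0 ht hq.ne_zero
  have hle := one_sub_le_moebiusProd ht0 ht hq.ne_zero
  rcases ArithmeticFunction.moebius_ne_zero_iff_eq_or.1
    (ArithmeticFunction.moebius_ne_zero_iff_squarefree.2 hq) with e | e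
  · rw [e, zpow_one]
    constructor <;> linarith
  · have h1 : radical n ≠ 1 := fun h => by rw [h] at e; simp at e
    have hlt' := one_sub_lt_moebiusProd ht0 ht hq.ne_zero h1
    rw [e, zpow_neg_one]
    have := (one_lt_inv₀ hpos).2 hlt
    refine ⟨by linarith, ?_⟩
    rw [inv_lt_comm₀ hpos two_pos]
    linarith

lemma prod_eval_cyclotomic {n : ℕ} (hn : 0 < n) (x : ℝ) :
    ∏ d ∈ n.divisors, (cyclotomic d ℝ).eval x = x ^ n - 1 := by
  rw [← eval_prod, prod_cyclotomic_eq_X_pow_sub_one hn]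
  simp

lemma eval_cyclotomic_ne_zero {x : ℝ} (h1 : |x| ≠ 1) {n : ℕ} (hn : 0 < n) :
    (cyclotomic n ℝ).eval x ≠ 0 := by
  have h := prod_eval_cyclotomic hn x
  have hne : x ^ n - 1 ≠ 0 := sub_ne_zero.2 fun h =>
    h1 ((pow_eq_one_iff_of_nonneg (abs_nonneg x) hn.ne').1 (by rw [← abs_pow, h, abs_one]))
  rw [← h] at hne
  exact Finset.prod_ne_zero_iff.1 hne n (Nat.mem_divisors_self n hn.ne')

lemma eval_cyclotomic_of_lt_one {x : ℝ} (h0 : 0 < x) (h1 : x < 1) {n : ℕ} (hn : 2 ≤ n) :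
    (cyclotomic n ℝ).eval x = normalizedCyclotomic n x := by
  set f : ℕ → ℝ := fun d => if d = 1 then -(cyclotomic d ℝ).eval x else (cyclotomic d ℝ).eval x
    with hf
  have hf0 : ∀ d : ℕ, 0 < d → f d ≠ 0 := by
    intro d hd
    have := eval_cyclotomic_ne_zero (by rw [abs_of_pos h0]; exact h1.ne) hd
    simp only [hf]
    split_ifs
    · exact neg_ne_zero.2 this
    · exact this
  have key := (ArithmeticFunction.prod_eq_iff_prod_pow_moebius_eq_of_nonzero (f := f)
    (g := fun d => 1 - x ^ d) hf0 (fun d hd => (one_sub_pow_pos h0 h1 hd.ne').ne')).1 ?_ n (by omega)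
  · rw [normalizedCyclotomic, key]
    simp only [hf]
    rw [if_neg (by omega)]
  · intro d hd
    have h := prod_eval_cyclotomic hd x
    have hmem := Nat.one_mem_divisors.2 hd.ne'
    rw [← Finset.mul_prod_erase _ _ hmem] at h ⊢
    have : ∏ i ∈ d.divisors.erase 1, f i = ∏ i ∈ d.divisors.erase 1, (cyclotomic i ℝ).eval x :=
      Finset.prod_congr rfl fun i hi => if_neg (Finset.ne_of_mem_erase hi)
    rw [this]
    simp only [hf, if_true]
    linarith

lemma eval_cyclotomic_of_one_lt {y : ℝ} (h1 : 1 < y) {n : ℕ} (hn : 0 < n) :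
    (cyclotomic n ℝ).eval y = y ^ n.totient * normalizedCyclotomic n y⁻¹ := by
  have hy0 : 0 < y := by linarith
  have key := (ArithmeticFunction.prod_eq_iff_prod_pow_moebius_eq_of_nonzero
    (f := fun d => (cyclotomic d ℝ).eval y / y ^ d.totient)
    (g := fun d => 1 - y⁻¹ ^ d)
    (fun d hd => div_ne_zero (eval_cyclotomic_ne_zero (by rw [abs_of_pos hy0]; exact h1.ne') hd) (by positivity))
    (fun d hd => (one_sub_pow_pos (inv_pos.2 hy0) (inv_lt_one_of_one_lt₀ h1) hd.ne').ne')).1 ?_ n hn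
  · rw [normalizedCyclotomic, key]
    field_simp
  · intro d hd
    rw [Finset.prod_div_distrib, prod_eval_cyclotomic hd, Finset.prod_pow_eq_pow_sum,
      Nat.sum_totient, inv_pow]
    field_simp

lemma prod_eval_cyclotomic_two_mul {x : ℝ} (h1 : |x| ≠ 1) {n : ℕ} (hn : Odd n) :
    ∏ d ∈ n.divisors, (cyclotomic (2 * d) ℝ).eval x = x ^ n + 1 := by
  have hexp : ∀ d ∈ n.divisors, (cyclotomic d ℝ).eval (x ^ 2) =
      (cyclotomic (2 * d) ℝ).eval x * (cyclotomic d ℝ).eval x := by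
    intro d hd
    have hodd : ¬ 2 ∣ d := fun h => by
      have := h.trans (Nat.dvd_of_mem_divisors hd)
      exact (Nat.not_even_iff_odd.2 hn) (even_iff_two_dvd.2 this)
    rw [← expand_eval, cyclotomic_expand_eq_cyclotomic_mul Nat.prime_two hodd, eval_mul,
      mul_comm d 2]
  have h := Finset.prod_congr rfl hexp
  rw [Finset.prod_mul_distrib, prod_eval_cyclotomic hn.pos, prod_eval_cyclotomic hn.pos] at h
  have hne : x ^ n - 1 ≠ 0 := by
    rw [← prod_eval_cyclotomic hn.pos]
    exact Finset.prod_ne_zero_iff.2 fun d hd =>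
      eval_cyclotomic_ne_zero h1 (Nat.pos_of_mem_divisors hd)
  apply mul_right_cancel₀ hne
  rw [← h]
  ring

lemma eval_cyclotomic_two_mul_of_odd {x : ℝ} (h1 : |x| ≠ 1) {n : ℕ} (hn : Odd n) (hn1 : n ≠ 1) :
    (cyclotomic (2 * n) ℝ).eval x = (cyclotomic n ℝ).eval (-x) := by
  induction n using Nat.strong_induction_on with
  | _ n ih =>
    have hx2 : x + 1 ≠ 0 := fun h => h1 (by rw [eq_neg_of_add_eq_zero_left h]; simp)
    have h := prod_eval_cyclotomic_two_mul h1 hn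
    have h' := prod_eval_cyclotomic hn.pos (-x)
    have h1mem : 1 ∈ n.divisors := Nat.one_mem_divisors.2 hn.pos.ne'
    have hnmem : n ∈ n.divisors.erase 1 :=
      Finset.mem_erase.2 ⟨hn1, Nat.mem_divisors_self n hn.pos.ne'⟩
    rw [← Finset.mul_prod_erase _ _ h1mem, ← Finset.mul_prod_erase _ _ hnmem] at h h'
    have hprod : ∏ d ∈ (n.divisors.erase 1).erase n, (cyclotomic (2 * d) ℝ).eval x =
        ∏ d ∈ (n.divisors.erase 1).erase n, (cyclotomic d ℝ).eval (-x) := by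
      refine Finset.prod_congr rfl fun d hd => ?_
      simp only [Finset.mem_erase, Nat.mem_divisors] at hd
      exact ih d (lt_of_le_of_ne (Nat.le_of_dvd hn.pos hd.2.2.1) hd.1)
        (hn.of_dvd_nat hd.2.2.1) hd.2.1
    have hne : ∏ d ∈ (n.divisors.erase 1).erase n, (cyclotomic (2 * d) ℝ).eval x ≠ 0 :=
      Finset.prod_ne_zero_iff.2 fun d hd => eval_cyclotomic_ne_zero h1 (by
        have := Nat.pos_of_mem_divisors (Finset.mem_of_mem_erase (Finset.mem_of_mem_erase hd))
        omega)
    rw [← hprod, hn.neg_pow] at h'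
    simp only [mul_one, cyclotomic_two, cyclotomic_one, eval_add, eval_sub, eval_X,
      eval_one] at h h'
    apply mul_right_cancel₀ (mul_ne_zero hx2 hne)
    linear_combination h + h'

/-- The index with `Φ_n(-x) = Φ_{reflectIndex n}(x)` for `2 < n`. -/
def reflectIndex (n : ℕ) : ℕ :=
  if n % 2 = 1 then 2 * n else if n % 4 = 0 then n else n / 2

lemma reflectIndex_injective {m n : ℕ} (h : reflectIndex m = reflectIndex n) : m = n := by
  unfold reflectIndex at h
  split_ifs at h <;> omega

lemma reflectIndex_pos {n : ℕ} (hn : 0 < n) : 0 < reflectIndex n := by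
  unfold reflectIndex
  split_ifs <;> omega

lemma two_lt_reflectIndex {n : ℕ} (hn : 2 < n) : 2 < reflectIndex n := by
  unfold reflectIndex
  split_ifs <;> omega

lemma eval_cyclotomic_neg {x : ℝ} (h1 : |x| ≠ 1) {n : ℕ} (hn : 2 < n) :
    (cyclotomic n ℝ).eval (-x) = (cyclotomic (reflectIndex n) ℝ).eval x := by
  unfold reflectIndex
  split_ifs with h h4
  · exact (eval_cyclotomic_two_mul_of_odd h1 (Nat.odd_iff.2 h) (by omega)).symm
  · obtain ⟨k, rfl⟩ : ∃ k, n = k * 2 := ⟨n / 2, by omega⟩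
    rw [← cyclotomic_expand_eq_cyclotomic Nat.prime_two (show 2 ∣ k by omega), expand_eval,
      expand_eval, neg_sq]
  · obtain ⟨k, rfl⟩ : ∃ k, n = 2 * k := ⟨n / 2, by omega⟩
    rw [eval_cyclotomic_two_mul_of_odd (by rwa [abs_neg]) (Nat.odd_iff.2 (by omega)) (by omega),
      neg_neg, Nat.mul_div_cancel_left k two_pos]

lemma eq_of_totient_eq_two {n : ℕ} (h : n.totient = 2) : n = 3 ∨ n = 4 ∨ n = 6 := by
  have hn : n ≠ 0 := by rintro rfl; simp at h
  have hdvd : ∀ d, d ∣ n → d.totient ∣ 2 := fun d hd => h ▸ Nat.totient_dvd_of_dvd hd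
  obtain ⟨a, k, hk2, hk⟩ := Nat.exists_eq_pow_mul_and_not_dvd hn 2 (by norm_num)
  have hk0 : k ≠ 0 := by rintro rfl; simp at hk2
  obtain ⟨b, l, hl3, hl⟩ := Nat.exists_eq_pow_mul_and_not_dvd hk0 3 (by norm_num)
  have hl1 : l = 1 := by
    by_contra hl1
    have hp := Nat.minFac_prime hl1
    have hpl := Nat.minFac_dvd l
    have hlk : l ∣ k := hl ▸ dvd_mul_left _ _
    have hkn : k ∣ n := hk ▸ dvd_mul_left _ _
    have hle := Nat.le_of_dvd two_pos (Nat.totient_prime hp ▸ hdvd _ ((hpl.trans hlk).trans hkn))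
    have h2 := hp.two_le
    obtain h' | h' : l.minFac = 2 ∨ l.minFac = 3 := by omega
    · exact hk2 (h' ▸ hpl.trans hlk)
    · exact hl3 (h' ▸ hpl)
  subst hl1
  have ha : a < 3 := by
    by_contra! ha
    have h8 := hdvd (2 ^ 3) ((pow_dvd_pow 2 ha).trans (hk ▸ dvd_mul_right _ _))
    revert h8
    decide
  have hb : b < 2 := by
    by_contra! hb
    have h9 := hdvd (3 ^ 2) (((pow_dvd_pow 3 hb).trans (hl ▸ dvd_mul_right _ _)).trans
      (hk ▸ dvd_mul_left _ _))
    revert h9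
    decide
  subst hl
  subst hk
  interval_cases a <;> interval_cases b <;> revert h <;> decide

lemma cyclotomic_four_real : cyclotomic 4 ℝ = X ^ 2 + 1 := by
  rw [show 4 = 2 * 2 by norm_num, ← cyclotomic_expand_eq_cyclotomic Nat.prime_two dvd_rfl]
  simp [cyclotomic_two]

lemma eval_cyclotomic_eq_of_two_le {y : ℝ} (hy : 2 ≤ y) {m n : ℕ} (hm : 0 < m) (hn : 0 < n)
    (hmn : m ≠ n) (hle : m.totient ≤ n.totient)
    (h : (cyclotomic m ℝ).eval y = (cyclotomic n ℝ).eval y) : m = 2 ∧ n = 6 ∧ y = 2 := by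
  obtain ⟨j, hj⟩ := Nat.exists_eq_add_of_le hle
  have hy0 : 0 < y := by linarith
  have hi0 : 0 < y⁻¹ := inv_pos.2 hy0
  have hi : y⁻¹ ≤ 1 / 2 := by
    rw [one_div]
    exact inv_anti₀ two_pos hy
  have hF := h
  rw [eval_cyclotomic_of_one_lt (by linarith) hm, eval_cyclotomic_of_one_lt (by linarith) hn, hj,
    pow_add, mul_assoc] at hF
  have hF := mul_left_cancel₀ (pow_ne_zero _ hy0.ne') hF
  rcases (show j = 0 ∨ j = 1 ∨ 2 ≤ j by omega) with rfl | rfl | hj2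
  · rw [pow_zero, one_mul] at hF
    exact absurd (normalizedCyclotomic_injective hi0 hi hm.ne' hn.ne' hF) hmn
  · have hm2 : m ≤ 2 := by
      by_contra! hm2
      have hme := Nat.totient_even hm2
      have hmp := Nat.totient_pos.2 hm
      have hn2 : 2 < n := by
        by_contra! hn2
        interval_cases n <;> simp at hj <;> omega
      have hne := Nat.totient_even hn2
      rw [hj] at hne
      grind
    have hmt : m.totient = 1 := Nat.totient_eq_one_iff.2 (by omega)
    rcases eq_of_totient_eq_two (n := n) (by omega) with rfl | rfl | rfl <;>
      interval_cases m <;>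
      simp [cyclotomic_two, cyclotomic_three, cyclotomic_four_real, cyclotomic_six] at h ⊢ <;>
      nlinarith
  · exfalso
    have h4 : 4 ≤ y ^ j :=
      calc (4 : ℝ) = 2 ^ 2 := by norm_num
        _ ≤ y ^ 2 := by gcongr
        _ ≤ y ^ j := pow_le_pow_right₀ (by linarith) hj2
    have h1 := (normalizedCyclotomic_mem_Ico hi0 hi hm.ne').2
    have h2 := (normalizedCyclotomic_mem_Ico hi0 hi hn.ne').1
    nlinarith

lemma eval_cyclotomic_coincidence_of_two_le {y : ℝ} (hy : 2 ≤ y) {m n : ℕ} (hm : 0 < m)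
    (hn : 0 < n) (hmn : m ≠ n) (h : (cyclotomic m ℝ).eval y = (cyclotomic n ℝ).eval y) :
    ({m, n} : Set ℕ) = {2, 6} ∧ y = 2 := by
  rcases le_total m.totient n.totient with hle | hle
  · obtain ⟨rfl, rfl, hy2⟩ := eval_cyclotomic_eq_of_two_le hy hm hn hmn hle h
    exact ⟨rfl, hy2⟩
  · obtain ⟨rfl, rfl, hy2⟩ := eval_cyclotomic_eq_of_two_le hy hn hm hmn.symm hle h.symm
    exact ⟨Set.pair_comm _ _, hy2⟩

lemma eval_cyclotomic_neg_of_lt_one {x : ℝ} (h0 : 0 < x) (h1 : x < 1) {n : ℕ} (hn : 2 ≤ n) :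
    (cyclotomic n ℝ).eval (-x) = normalizedCyclotomic (reflectIndex n) x := by
  rcases (show n = 2 ∨ 2 < n by omega) with rfl | hn2
  · simp [cyclotomic_two, reflectIndex, normalizedCyclotomic]
    ring
  · rw [eval_cyclotomic_neg (by rw [abs_of_pos h0]; exact h1.ne) hn2,
      eval_cyclotomic_of_lt_one h0 h1 (two_lt_reflectIndex hn2).le]

lemma eval_cyclotomic_one_neg {x : ℝ} (hx : x < 1) : (cyclotomic 1 ℝ).eval x < 0 := by
  simpa using hx

lemma eval_cyclotomic_injective_of_abs_le_half {x : ℝ} (hx : x ≠ 0) (h2 : |x| ≤ 1 / 2) {m n : ℕ}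
    (hm : 0 < m) (hn : 0 < n) (h : (cyclotomic m ℝ).eval x = (cyclotomic n ℝ).eval x) :
    m = n := by
  have hle := abs_le.1 h2
  have hpos : ∀ k : ℕ, 2 ≤ k → 0 < (cyclotomic k ℝ).eval x := by
    intro k hk
    rcases (show k = 2 ∨ 2 < k by omega) with rfl | hk2
    · simp only [cyclotomic_two, eval_add, eval_X, eval_one]
      linarith
    · exact cyclotomic_pos hk2 x
  have hneg := eval_cyclotomic_one_neg (show x < 1 by linarith)
  rcases (show m = 1 ∨ 2 ≤ m by omega) with rfl | hm2 <;>
    rcases (show n = 1 ∨ 2 ≤ n by omega) with rfl | hn2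
  · rfl
  · linarith [hpos n hn2]
  · linarith [hpos m hm2]
  · rcases lt_or_gt_of_ne hx with hx0 | hx0
    · obtain ⟨z, rfl⟩ : ∃ z, x = -z := ⟨-x, by ring⟩
      have hz0 : 0 < z := by linarith
      have hz : z ≤ 1 / 2 := by linarith
      rw [eval_cyclotomic_neg_of_lt_one hz0 (by linarith) hm2,
        eval_cyclotomic_neg_of_lt_one hz0 (by linarith) hn2] at h
      exact reflectIndex_injective (normalizedCyclotomic_injective hz0 hz
        (reflectIndex_pos hm).ne' (reflectIndex_pos hn).ne' h)
    · rw [eval_cyclotomic_of_lt_one hx0 (by linarith) hm2,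
        eval_cyclotomic_of_lt_one hx0 (by linarith) hn2] at h
      exact normalizedCyclotomic_injective hx0 hle.2 hm.ne' hn.ne' h

lemma eval_cyclotomic_injective_of_le_neg_two {x : ℝ} (hx : x ≤ -2) {m n : ℕ}
    (hm : 0 < m) (hn : 0 < n) (h : (cyclotomic m ℝ).eval x = (cyclotomic n ℝ).eval x) :
    m = n := by
  have h1 : (cyclotomic 1 ℝ).eval x = x - 1 := by simp
  have h2 : (cyclotomic 2 ℝ).eval x = x + 1 := by simp [cyclotomic_two]
  rcases (show m ≤ 2 ∨ 2 < m by omega) with hm2 | hm2 <;>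
    rcases (show n ≤ 2 ∨ 2 < n by omega) with hn2 | hn2
  · interval_cases m <;> interval_cases n <;> first | rfl | linarith
  · have := cyclotomic_pos hn2 x
    interval_cases m <;> linarith
  · have := cyclotomic_pos hm2 x
    interval_cases n <;> linarith
  · by_contra hmn
    obtain ⟨z, rfl⟩ : ∃ z, x = -z := ⟨-x, by ring⟩
    have hz : 2 ≤ z := by linarith
    have hz1 : |z| ≠ 1 := by rw [abs_of_pos (by linarith)]; linarith
    rw [eval_cyclotomic_neg hz1 hm2, eval_cyclotomic_neg hz1 hn2] at h
    obtain ⟨hset, -⟩ := eval_cyclotomic_coincidence_of_two_le hz (reflectIndex_pos hm)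
      (reflectIndex_pos hn) (fun e => hmn (reflectIndex_injective e)) h
    have hmem : (2 : ℕ) ∈ ({reflectIndex m, reflectIndex n} : Set ℕ) := by simp [hset]
    have := two_lt_reflectIndex hm2
    have := two_lt_reflectIndex hn2
    rcases hmem with e | e
    · omega
    · simp only [Set.mem_singleton_iff] at e
      omega

theorem cyclotomic_coincidence_principal (m n : ℕ) (hm : 0 < m) (hn : 0 < n) (hmn : m ≠ n)
    (x : ℝ) (hx : x ≠ 0)
    (h : (Polynomial.cyclotomic m ℝ).eval x = (Polynomial.cyclotomic n ℝ).eval x) :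
    (1 / 2 < |x| ∧ |x| < 2) ∨ (({m, n} : Set ℕ) = {2, 6} ∧ x = 2) := by
  rcases le_or_gt |x| (1 / 2) with h1 | h1
  · exact absurd (eval_cyclotomic_injective_of_abs_le_half hx h1 hm hn h) hmn
  rcases lt_or_ge |x| 2 with h2 | h2
  · exact Or.inl ⟨h1, h2⟩
  rcases le_abs.1 h2 with h2 | h2
  · exact Or.inr (eval_cyclotomic_coincidence_of_two_le h2 hm hn hmn h)
  · exact absurd (eval_cyclotomic_injective_of_le_neg_two (by linarith) hm hn h) hmn
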